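/- Let a be an integer with |a| > 1 such that gcd(5, a − 1) = 1. Then gcd(7·k_5(a) − 1, Φ_4(a²)) divides 2·337 and gcd(7·k_5(a) − 1, Φ_3(a²)) divides 3·19·43. -/

import Mathlib

/-- `e(r,a)`: for odd prime `r` coprime to `a`, the multiplicative order of `a` modulo `r`;
for `r = 2` and odd `a`, it is `1` if `a ≡ 1 (mod 4)` and `2` if `a ≡ 3 (mod 4)`. -/
noncomputable def eOrd (r : ℕ) (a : ℤ) : ℕ :=
  if r = 2 then (if a % 4 = 1 then 1 else 2) else orderOf (a : ZMod r)

/-- `k_i(a)`: the product, over all primitive prime divisors `r` of `a^i - 1`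
(i.e. primes `r` with `e(r,a) = i`), of the `r`-part of `a^i - 1`. -/
noncomputable def kPart (i : ℕ) (a : ℤ) : ℕ :=
  ∏ r ∈ (a ^ i - 1).natAbs.primeFactors.filter (fun r => eOrd r a = i),
    r ^ (a ^ i - 1).natAbs.factorization r

theorem natAbs_pow_five_sub_one (a : ℤ) :
    (a ^ 5 - 1).natAbs = (a - 1).natAbs * (a ^ 4 + a ^ 3 + a ^ 2 + a + 1).natAbs := by
  rw [← Int.natAbs_mul]
  congr 1
  ring

theorem coprime_sub_one_quintic {a : ℤ} (h5 : Int.gcd 5 (a - 1) = 1) :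
    Nat.Coprime (a - 1).natAbs (a ^ 4 + a ^ 3 + a ^ 2 + a + 1).natAbs := by
  have h : IsCoprime (a - 1) 5 := (Int.isCoprime_iff_gcd_eq_one.mpr h5).symm
  rw [← Int.isCoprime_iff_nat_coprime]
  have e : a ^ 4 + a ^ 3 + a ^ 2 + a + 1 = 5 + (a - 1) * (a ^ 3 + 2 * a ^ 2 + 3 * a + 4) := by
    ring
  rw [e]
  exact h.add_mul_left_right _

theorem eOrd_eq_five_iff {a : ℤ} (h5 : Int.gcd 5 (a - 1) = 1) {r : ℕ} (hr : r.Prime)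
    (hdvd : r ∣ (a ^ 5 - 1).natAbs) :
    eOrd r a = 5 ↔ r ∣ (a ^ 4 + a ^ 3 + a ^ 2 + a + 1).natAbs := by
  unfold eOrd
  by_cases h2 : r = 2
  · subst h2
    have hodd : ¬ 2 ∣ (a ^ 4 + a ^ 3 + a ^ 2 + a + 1).natAbs := by
      rw [← Int.natCast_dvd, Nat.cast_ofNat, ← even_iff_two_dvd]
      simp [Int.even_add, Int.even_pow]
    refine iff_of_false ?_ hodd
    rw [if_pos rfl]
    split_ifs <;> norm_num
  · rw [if_neg h2]
    have : Fact r.Prime := ⟨hr⟩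
    have hpow : (a : ZMod r) ^ 5 = 1 := by
      have h := (ZMod.intCast_zmod_eq_zero_iff_dvd (a ^ 5 - 1) r).mpr (Int.natCast_dvd.mpr hdvd)
      push_cast at h
      exact sub_eq_zero.mp h
    have : Fact (Nat.Prime 5) := ⟨by norm_num⟩
    have hone : (a : ZMod r) = 1 ↔ r ∣ (a - 1).natAbs := by
      rw [← Int.natCast_dvd, ← ZMod.intCast_zmod_eq_zero_iff_dvd]
      push_cast
      exact sub_eq_zero.symm
    have hmul := hdvd
    rw [natAbs_pow_five_sub_one, hr.dvd_mul, ← hone] at hmul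
    constructor
    · intro ho
      refine hmul.resolve_left fun h => ?_
      rw [h, orderOf_one] at ho
      omega
    · intro hd
      refine orderOf_eq_prime hpow fun h => hr.one_lt.ne' ?_
      exact Nat.eq_one_of_dvd_coprimes (coprime_sub_one_quintic h5) (hone.mp h) hd

theorem kPart_five_of_gcd_eq_one {a : ℤ} (ha : 1 < a.natAbs) (h5 : Int.gcd 5 (a - 1) = 1) :
    (kPart 5 a : ℤ) = a ^ 4 + a ^ 3 + a ^ 2 + a + 1 := by
  have hpos : 0 < a ^ 4 + a ^ 3 + a ^ 2 + a + 1 := by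
    nlinarith [sq_nonneg (2 * a ^ 2 + a), sq_nonneg (a + 1), sq_nonneg a]
  have hn : (a ^ 4 + a ^ 3 + a ^ 2 + a + 1).natAbs ≠ 0 := by omega
  have hm : (a - 1).natAbs ≠ 0 := by omega
  have hco := coprime_sub_one_quintic h5
  have hfilter : (a ^ 5 - 1).natAbs.primeFactors.filter (fun r => eOrd r a = 5) =
      (a ^ 4 + a ^ 3 + a ^ 2 + a + 1).natAbs.primeFactors := by
    ext r
    rw [Finset.mem_filter, Nat.mem_primeFactors, Nat.mem_primeFactors]
    constructor
    · rintro ⟨⟨hr, hd, -⟩, he⟩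
      exact ⟨hr, (eOrd_eq_five_iff h5 hr hd).mp he, hn⟩
    · rintro ⟨hr, hd, -⟩
      have hd' : r ∣ (a ^ 5 - 1).natAbs :=
        natAbs_pow_five_sub_one a ▸ hd.mul_left _
      refine ⟨⟨hr, hd', ?_⟩, (eOrd_eq_five_iff h5 hr hd').mpr hd⟩
      rw [natAbs_pow_five_sub_one]
      exact mul_ne_zero hm hn
  have hk : kPart 5 a = (a ^ 4 + a ^ 3 + a ^ 2 + a + 1).natAbs := by
    unfold kPart
    rw [hfilter]
    conv_rhs => rw [← Nat.prod_factorization_pow_eq_self hn]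
    refine Finset.prod_congr rfl fun r hr => ?_
    rw [natAbs_pow_five_sub_one,
      Nat.factorization_eq_of_coprime_right hco (Nat.mem_primeFactors_iff_mem_primeFactorsList.mp hr)]
  rw [hk, Int.natAbs_of_nonneg hpos.le]

theorem Polynomial.cyclotomic_four_eval (x : ℤ) :
    (Polynomial.cyclotomic 4 ℤ).eval x = x ^ 2 + 1 := by
  have : Fact (Nat.Prime 2) := ⟨Nat.prime_two⟩
  rw [show 4 = 2 ^ (1 + 1) by norm_num, Polynomial.cyclotomic_prime_pow_eq_geom_sum Nat.prime_two]
  simp [Finset.sum_range_succ, add_comm]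

/-- For `|a| > 1` with `gcd(5, a-1) = 1`: `gcd(7k_5(a)-1, Φ_4(a²))` divides `2·337`
and `gcd(7k_5(a)-1, Φ_3(a²))` divides `3·19·43`. -/
theorem gcd_k5_cyclotomic_of_one (a : ℤ) (ha : 1 < a.natAbs)
    (h5 : Int.gcd 5 (a - 1) = 1) :
    Int.gcd (7 * (kPart 5 a : ℤ) - 1) ((Polynomial.cyclotomic 4 ℤ).eval (a ^ 2)) ∣ 2 * 337 ∧
    Int.gcd (7 * (kPart 5 a : ℤ) - 1) ((Polynomial.cyclotomic 3 ℤ).eval (a ^ 2)) ∣ 3 * 19 * 43 := by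
  rw [kPart_five_of_gcd_eq_one ha h5, Polynomial.cyclotomic_four_eval, Polynomial.cyclotomic_three]
  simp only [Polynomial.eval_add, Polynomial.eval_pow, Polynomial.eval_X, Polynomial.eval_one]
  refine ⟨Int.gcd_dvd_iff.mpr ⟨-37 - 63 * a + 84 * a ^ 2 - 112 * a ^ 3,
      637 + 196 * a + 784 * a ^ 2 - 7 * (-37 - 63 * a + 84 * a ^ 2 - 112 * a ^ 3), ?_⟩,
    Int.gcd_dvd_iff.mpr ⟨-1 - 350 * a + 49 * a ^ 2 - 7 * a ^ 3,
      2450 - 343 * a + 49 * a ^ 2 - 7 * (-1 - 350 * a + 49 * a ^ 2 - 7 * a ^ 3), ?_⟩⟩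
  · push_cast
    ring
  · push_cast
    ring
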